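/- Let T(n) denote the set of tournament matrices of size n, i.e., matrices a ∈ M_n({0,1}) with a_{i,i}=0 and a_{i,j}+a_{j,i}=1 for i≠j. For λ a partition of C(n,2) with at most n parts, let N_λ = #{a ∈ T(n) : the sorted row sums of a equal λ}. Then N_λ ≠ 0 if and only if λ ⪯ (n−1, n−2, …, 1, 0) in the dominance order of partitions. -/

import Mathlib

open Finset

/-- A tournament matrix: 0/1 entries (here booleans), zero diagonal, and
`a i j + a j i = 1` for `i ≠ j`. -/
def IsTournament {n : ℕ} (a : Matrix (Fin n) (Fin n) Bool) : Prop :=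
  (∀ i, a i i = false) ∧ ∀ i j, i ≠ j → a i j = !a j i

/-- The `i`-th row sum of a boolean matrix. -/
def rowSum {n : ℕ} (a : Matrix (Fin n) (Fin n) Bool) (i : Fin n) : ℕ :=
  (Finset.univ.filter fun j => a i j = true).card

/-- The multiset of row sums of `a` coincides with the multiset of parts of `lam`
(i.e. the sorted row sums of `a` are the partition `lam`). -/
def sortedRowSumsEq {n : ℕ} (a : Matrix (Fin n) (Fin n) Bool) (lam : Fin n → ℕ) : Prop :=
  Multiset.map (rowSum a) Finset.univ.val = Multiset.map lam Finset.univ.val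

/-- `N_λ`: the number of tournament matrices of size `n` whose sorted row sums are `lam`. -/
noncomputable def Nlam (n : ℕ) (lam : Fin n → ℕ) : ℕ :=
  {a : Matrix (Fin n) (Fin n) Bool | IsTournament a ∧ sortedRowSumsEq a lam}.ncard

/-- Partial sum `f 0 + ... + f i`. -/
def partialSum {n : ℕ} (f : Fin n → ℕ) (i : Fin n) : ℕ :=
  ∑ k ∈ Finset.univ.filter (fun k => k ≤ i), f k

/-- The staircase partition `(n-1, n-2, ..., 1, 0)`. -/
def stair (n : ℕ) : Fin n → ℕ := fun i => n - 1 - i.val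

/-- A tournament has `#S` choose `2` arcs inside any vertex set `S`. -/
theorem IsTournament.card_arcs {n : ℕ} {a : Matrix (Fin n) (Fin n) Bool} (ha : IsTournament a)
    (S : Finset (Fin n)) :
    ∑ i ∈ S, (S.filter fun j => a i j = true).card = S.card.choose 2 := by
  have hswap : ∑ i ∈ S, (S.filter fun j => a i j = true).card
      = ∑ i ∈ S, (S.filter fun j => a j i = true).card := by
    simp only [Finset.card_filter]
    exact Finset.sum_comm
  have hdeg : ∀ i ∈ S, (S.filter fun j => a i j = true).card
      + (S.filter fun j => a j i = true).card = S.card - 1 := by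
    intro i hi
    rw [← Finset.card_erase_of_mem hi, ← Finset.card_union_of_disjoint]
    · congr 1
      ext j
      rcases eq_or_ne i j with rfl | hij
      · simp [ha.1]
      · have := ha.2 i j hij
        cases h : a j i <;> simp_all [hij.symm]
    · rw [Finset.disjoint_filter]
      intro j _ h₁ h₂
      rcases eq_or_ne i j with rfl | hij
      · simp [ha.1] at h₁
      · have := ha.2 i j hij
        simp_all
  have htwo := Finset.sum_congr rfl hdeg
  rw [Finset.sum_add_distrib, ← hswap, Finset.sum_const, smul_eq_mul] at htwo
  rw [Nat.choose_two_right, ← htwo]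
  omega

theorem IsTournament.choose_two_le_sum_rowSum {n : ℕ} {a : Matrix (Fin n) (Fin n) Bool}
    (ha : IsTournament a) (S : Finset (Fin n)) :
    S.card.choose 2 ≤ ∑ i ∈ S, rowSum a i := by
  rw [← ha.card_arcs S]
  exact Finset.sum_le_sum fun i _ =>
    Finset.card_le_card (Finset.filter_subset_filter _ (Finset.subset_univ S))

/-- **Landau's theorem**, sufficiency: a prescribed score sequence with the right total whose
sums over vertex sets are large enough is realised by a tournament. -/
theorem exists_isTournament_rowSum_eq {n : ℕ} {lam : Fin n → ℕ}
    (hsum : ∑ i, lam i = n.choose 2)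
    (h : ∀ S : Finset (Fin n), S.card.choose 2 ≤ ∑ i ∈ S, lam i) :
    ∃ a : Matrix (Fin n) (Fin n) Bool, IsTournament a ∧ rowSum a = lam := by
  classical
  let t : {e : Sym2 (Fin n) // ¬ e.IsDiag} → Finset (Σ i, Fin (lam i)) :=
    fun e => Finset.univ.filter fun s => s.1 ∈ e.1
  obtain ⟨f, hf, hft⟩ := (Finset.all_card_le_biUnion_card_iff_exists_injective t).1 (by
    intro A
    let V : Finset (Fin n) := Finset.univ.filter fun v => ∃ e ∈ A, v ∈ e.1
    have hV : A.biUnion t = V.sigma fun _ => Finset.univ := by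
      ext s
      simp [t, V]
    rw [hV, Finset.card_sigma]
    simp only [Finset.card_univ, Fintype.card_fin]
    refine le_trans ?_ (h V)
    rw [← Sym2.card_image_offDiag, ← Finset.card_map (Function.Embedding.subtype _)]
    refine Finset.card_le_card fun e he => ?_
    simp only [Finset.mem_map, Function.Embedding.subtype_apply] at he
    obtain ⟨⟨e, hd⟩, heA, rfl⟩ := he
    induction e with
    | _ x y =>
      refine Finset.mem_image.2 ⟨(x, y), ?_, rfl⟩
      simp only [Finset.mem_offDiag, V, Finset.mem_filter, Finset.mem_univ, true_and]
      exact ⟨⟨_, heA, by simp⟩, ⟨_, heA, by simp⟩, by simpa using hd⟩)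
  have hmem : ∀ e, (f e).1 ∈ e.1 := fun e => by simpa [t] using hft e
  let a : Matrix (Fin n) (Fin n) Bool := fun i j =>
    decide (∃ hij : i ≠ j, (f ⟨s(i, j), by simpa using hij⟩).1 = i)
  have ha : IsTournament a := by
    refine ⟨fun i => by simp [a], fun i j hij => ?_⟩
    have hm := hmem ⟨s(i, j), by simpa using hij⟩
    have he : (⟨s(j, i), by simpa using hij.symm⟩ : {e : Sym2 (Fin n) // ¬ e.IsDiag})
        = ⟨s(i, j), by simpa using hij⟩ := Subtype.ext Sym2.eq_swap
    simp only [a, he, hij, hij.symm, ne_eq, not_false_eq_true, exists_true_left]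
    rcases Sym2.mem_iff.1 hm with h | h <;> simp [h, hij, hij.symm]
  have hle : ∀ i ∈ (Finset.univ : Finset (Fin n)), rowSum a i ≤ lam i := by
    intro i _
    have hc : (({i} : Finset (Fin n)).sigma
        fun i => (Finset.univ : Finset (Fin (lam i)))).card = lam i := by
      simp
    rw [← hc]
    have hne : ∀ j ∈ Finset.univ.filter (fun j => a i j = true), i ≠ j ∧
        ∀ hd, (f ⟨s(i, j), hd⟩).1 = i := by
      intro j hj
      obtain ⟨hij, hfi⟩ := of_decide_eq_true (Finset.mem_filter.1 hj).2
      exact ⟨hij, fun _ => hfi⟩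
    refine Finset.card_le_card_of_forall_subsingleton
      (fun j s => ∃ hd, f ⟨s(i, j), hd⟩ = s) (fun j hj => ?_) (fun s _ => ?_)
    · have hd : ¬ s(i, j).IsDiag := by simpa using (hne j hj).1
      exact ⟨_, by simp [(hne j hj).2 hd], hd, rfl⟩
    · rintro j ⟨_, _, hj⟩ k ⟨_, _, hk⟩
      exact Sym2.congr_right.1 (congrArg Subtype.val (hf (hj.trans hk.symm)))
  refine ⟨a, ha, funext fun i => ?_⟩
  refine (Finset.sum_eq_sum_iff_of_le hle).1 ?_ i (Finset.mem_univ i)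
  rw [hsum]
  simpa [rowSum] using ha.card_arcs Finset.univ

theorem Antitone.sum_Ioi_le_sum_of_card_eq {n : ℕ} {f : Fin n → ℕ} (hf : Antitone f) (i : Fin n)
    {S : Finset (Fin n)} (hS : S.card = (Finset.Ioi i).card) :
    ∑ j ∈ Finset.Ioi i, f j ≤ ∑ j ∈ S, f j := by
  rw [← Finset.sum_sdiff_le_sum_sdiff]
  calc ∑ j ∈ Finset.Ioi i \ S, f j ≤ (Finset.Ioi i \ S).card • f i :=
        Finset.sum_le_card_nsmul _ _ _ fun j hj => hf (Finset.mem_Ioi.1 (Finset.mem_sdiff.1 hj).1).le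
    _ = (S \ Finset.Ioi i).card • f i := by rw [Finset.card_sdiff_comm hS]
    _ ≤ ∑ j ∈ S \ Finset.Ioi i, f j :=
        Finset.card_nsmul_le_sum _ _ _ fun j hj => hf (by simpa using (Finset.mem_sdiff.1 hj).2)

theorem partialSum_add_sum_Ioi {n : ℕ} (f : Fin n → ℕ) (i : Fin n) :
    partialSum f i + ∑ j ∈ Finset.Ioi i, f j = ∑ j, f j := by
  rw [partialSum, ← Finset.sum_filter_add_sum_filter_not Finset.univ (fun k => k ≤ i)]
  congr 2
  ext j
  simp

theorem sum_range_add_choose_two (n m : ℕ) (hm : m ≤ n) :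
    ∑ k ∈ Finset.range m, (n - 1 - k) + (n - m).choose 2 = n.choose 2 := by
  induction m with
  | zero => simp
  | succ m ih =>
    rw [← ih (by omega), Finset.sum_range_succ, show n - m = (n - (m + 1)) + 1 by omega,
      Nat.choose_succ_succ' _ 1, Nat.choose_one_right, ← Nat.add_assoc]
    congr 2
    omega

theorem partialSum_stair_add_choose_two {n : ℕ} (i : Fin n) :
    partialSum (stair n) i + (Finset.Ioi i).card.choose 2 = n.choose 2 := by
  rw [Fin.card_Ioi, ← sum_range_add_choose_two n (i + 1) i.isLt, Nat.sub_sub, Nat.add_comm 1]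
  congr 1
  refine Finset.sum_bij (fun k _ => k.val) (fun k hk => ?_) (fun k _ l _ h => Fin.ext h)
    (fun k hk => ?_) (fun k _ => rfl)
  · simpa [Nat.lt_succ_iff] using hk
  · have hk := Finset.mem_range.1 hk
    exact ⟨⟨k, by omega⟩, Finset.mem_filter.2 ⟨Finset.mem_univ _, Nat.le_of_lt_succ hk⟩, rfl⟩

theorem exists_perm_of_map_univ_eq {α β : Type*} [Fintype α] {f g : α → β}
    (h : Multiset.map f Finset.univ.val = Multiset.map g Finset.univ.val) :
    ∃ σ : Equiv.Perm α, ∀ i, g (σ i) = f i := by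
  classical
  have hcard : ∀ c, Fintype.card {i // f i = c} = Fintype.card {i // g i = c} := by
    intro c
    have hc := congrArg (Multiset.count c) h
    simp only [Multiset.count_map, eq_comm (a := c)] at hc
    rw [Fintype.card_subtype, Fintype.card_subtype]
    exact hc
  exact ⟨Equiv.ofFiberEquiv fun c => Fintype.equivOfCardEq (hcard c),
    fun i => Equiv.ofFiberEquiv_map _ i⟩

/-- Being dominated by the staircase, in terms of the sums of the smallest parts. -/
theorem partialSum_le_partialSum_stair_iff {n : ℕ} {lam : Fin n → ℕ}
    (hsum : ∑ i, lam i = n.choose 2) (i : Fin n) :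
    partialSum lam i ≤ partialSum (stair n) i ↔
      (Finset.Ioi i).card.choose 2 ≤ ∑ j ∈ Finset.Ioi i, lam j := by
  have h₁ := partialSum_add_sum_Ioi lam i
  have h₂ := partialSum_stair_add_choose_two i
  omega

/-- For `lam` a partition of `C(n,2)` with at most `n` parts, the number `N_λ` of
tournament matrices with sorted row sums `lam` is nonzero if and only if
`lam ⪯ (n−1, n−2, …, 1, 0)` in the dominance order. -/
theorem Nlam_ne_zero_iff_dominated (n : ℕ) (lam : Fin n → ℕ)
    (hmono : Antitone lam) (hsum : ∑ i, lam i = n.choose 2) :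
    Nlam n lam ≠ 0 ↔ ∀ i : Fin n, partialSum lam i ≤ partialSum (stair n) i := by
  rw [Nlam, ← Nat.pos_iff_ne_zero, Set.ncard_pos (Set.toFinite _)]
  simp only [partialSum_le_partialSum_stair_iff hsum]
  constructor
  · rintro ⟨a, ha, hal⟩ i
    obtain ⟨σ, hσ⟩ := exists_perm_of_map_univ_eq hal.symm
    have := ha.choose_two_le_sum_rowSum ((Finset.Ioi i).map σ.toEmbedding)
    rw [Finset.card_map, Finset.sum_map] at this
    simpa only [Equiv.coe_toEmbedding, hσ] using this
  · intro h
    obtain ⟨a, ha, rfl⟩ := exists_isTournament_rowSum_eq hsum fun S => by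
      rcases S.eq_empty_or_nonempty with rfl | hne
      · simp
      have hpos := hne.card_pos
      have hle := S.card_le_univ
      rw [Fintype.card_fin] at hle
      rcases hle.eq_or_lt with hn | hn
      · have hu : S = Finset.univ := Finset.eq_univ_of_card S (by simpa using hn)
        rw [hn, hu, hsum]
      · have hc : S.card = (Finset.Ioi (⟨n - S.card - 1, by omega⟩ : Fin n)).card := by
          rw [Fin.card_Ioi]
          simp only
          omega
        rw [hc]
        exact (h _).trans (hmono.sum_Ioi_le_sum_of_card_eq _ hc)
    exact ⟨a, ha, rfl⟩
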